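/- Let n ≥ 2 and let u be a smooth compactly supported function on the half-space {x ∈ ℝⁿ : x_n > 0} with ∫ u² dμ = 1, where dμ = x_n^{−n} dx is the hyperbolic volume measure. Then 2(1−n) ∫ u · x_n ∂u/∂x_n dμ + 4 ∫ (x_n ∂u/∂x_n)² dμ − 2 ∫ u · Δ_ℍ u dμ ≤ 6 ( ∫ (Δ_ℍ u)² dμ )^{1/2} − (n−1)², where Δ_ℍ u = x_n² ∑_{j=1}^{n} ∂²u/∂x_j² + (2−n) x_n ∂u/∂x_n. -/

import Mathlib

open MeasureTheory

/-- The partial derivative `∂u/∂x_j` of a function `u : ℝⁿ → ℝ`. -/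
noncomputable def pderiv' {n : ℕ} (j : Fin n) (u : (Fin n → ℝ) → ℝ) (x : Fin n → ℝ) : ℝ :=
  fderiv ℝ u x (Pi.single j 1)

/-- The Laplacian of the hyperbolic space `ℍⁿ` in the half-space model, where `ln` is the
index of the last coordinate `x_n`:
`Δ_ℍ u = x_n² ∑_j ∂²u/∂x_j² + (2-n) x_n ∂u/∂x_n`. -/
noncomputable def hypLap {n : ℕ} (ln : Fin n) (u : (Fin n → ℝ) → ℝ) (x : Fin n → ℝ) : ℝ :=
  (x ln) ^ 2 * ∑ j : Fin n, pderiv' j (pderiv' j u) x +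
    (2 - (n : ℝ)) * x ln * pderiv' ln u x

section HalfSpace

variable {n : ℕ} {ln : Fin n}

lemma measurableSet_halfSpace (ln : Fin n) : MeasurableSet {y : Fin n → ℝ | 0 < y ln} :=
  measurableSet_lt measurable_const (measurable_pi_apply ln)

/-- A continuous function compactly supported in the half-space stays continuous after
multiplication by a power of the height. -/
lemma continuous_mul_rpow_of_tsupport_subset {f : (Fin n → ℝ) → ℝ} (hf : Continuous f)
    (hs : tsupport f ⊆ {y | 0 < y ln}) (p : ℝ) : Continuous fun x => f x * x ln ^ p := by
  rw [continuous_iff_continuousAt]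
  intro x
  by_cases hx : x ∈ tsupport f
  · exact hf.continuousAt.mul
      ((continuous_apply ln).continuousAt.rpow_const (Or.inl (hs hx).ne'))
  · have h : (fun x => f x * x ln ^ p) =ᶠ[nhds x] fun _ => 0 := by
      filter_upwards [notMem_tsupport_iff_eventuallyEq.1 hx] with y hy
      simp [hy]
    exact continuousAt_const.congr h.symm

lemma integrable_mul_rpow_of_tsupport_subset {f : (Fin n → ℝ) → ℝ} (hf : Continuous f)
    (hc : HasCompactSupport f) (hs : tsupport f ⊆ {y | 0 < y ln}) (p : ℝ) :
    Integrable fun x => f x * x ln ^ p :=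
  (continuous_mul_rpow_of_tsupport_subset hf hs p).integrable_of_hasCompactSupport hc.mul_right

/-- Integration by parts in the half-space against a power of the height. -/
lemma setIntegral_pderiv_mul_rpow_add_eq_zero {g : (Fin n → ℝ) → ℝ} (hg : ContDiff ℝ 1 g)
    (hc : HasCompactSupport g) (hs : tsupport g ⊆ {y | 0 < y ln}) (p : ℝ) (j : Fin n) :
    ∫ x in {y : Fin n → ℝ | 0 < y ln}, (pderiv' j g x * x ln ^ p +
      g x * (Pi.single j 1 : Fin n → ℝ) ln * p * x ln ^ (p - 1)) = 0 := by
  set v : Fin n → ℝ := Pi.single j 1 with hv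
  have hdsub : tsupport (fun x => fderiv ℝ g x v) ⊆ tsupport g := tsupport_fderiv_apply_subset ℝ v
  have hd : ∀ x : Fin n → ℝ, 0 < x ln → HasFDerivAt (fun x : Fin n → ℝ => x ln ^ p)
      ((p * x ln ^ (p - 1)) • ContinuousLinearMap.proj (R := ℝ) (φ := fun _ : Fin n => ℝ) ln) x :=
    fun x hx => (ContinuousLinearMap.proj (R := ℝ) (φ := fun _ : Fin n => ℝ) ln
      |>.hasFDerivAt).rpow_const (Or.inl hx.ne')
  have hzero : ∀ x, x ∉ {y : Fin n → ℝ | 0 < y ln} → g x = 0 := fun x hx =>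
    image_eq_zero_of_notMem_tsupport fun h => hx (hs h)
  have hdzero : ∀ x, x ∉ {y : Fin n → ℝ | 0 < y ln} → fderiv ℝ g x v = 0 := fun x hx =>
    image_eq_zero_of_notMem_tsupport (f := fun x => fderiv ℝ g x v) fun h => hx (hs (hdsub h))
  have i₁ : Integrable fun x => fderiv ℝ g x v * x ln ^ p :=
    integrable_mul_rpow_of_tsupport_subset
      ((hg.continuous_fderiv one_ne_zero).clm_apply continuous_const)
      (hc.fderiv_apply ℝ v) (hdsub.trans hs) p
  have i₂ : Integrable fun x => g x * v ln * p * x ln ^ (p - 1) := by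
    have := (integrable_mul_rpow_of_tsupport_subset hg.continuous hc hs (p - 1)).const_mul
      (v ln * p)
    exact this.congr (.of_forall fun x => by ring)
  have e : ∀ x, fderiv ℝ (fun x : Fin n → ℝ => x ln ^ p) x v * g x =
      g x * v ln * p * x ln ^ (p - 1) := by
    intro x
    by_cases hx : 0 < x ln
    · rw [(hd x hx).fderiv]
      simp
      ring
    · simp [hzero x hx]
  have key := integral_mul_fderiv_eq_neg_fderiv_mul_of_integrable (μ := volume)
    (f := fun x : Fin n → ℝ => x ln ^ p) (g := g) (v := v)
    (i₂.congr (.of_forall fun x => (e x).symm))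
    (i₁.congr (.of_forall fun x => mul_comm _ _))
    ((integrable_mul_rpow_of_tsupport_subset hg.continuous hc hs p).congr
      (.of_forall fun x => mul_comm _ _))
    (fun x hx => (hd x (hs hx)).differentiableAt)
    (fun x _ => hg.differentiable one_ne_zero x)
  rw [setIntegral_eq_integral_of_forall_compl_eq_zero]
  · simp only [pderiv', ← hv]
    rw [integral_add i₁ i₂]
    simp only [e] at key
    simp only [mul_comm (fderiv ℝ g _ v)]
    rw [key, neg_add_cancel]
  · intro x hx
    simp [pderiv', ← hv, hzero x hx, hdzero x hx]

lemma ContDiff.pderiv' {u : (Fin n → ℝ) → ℝ} (hu : ContDiff ℝ (⊤ : ℕ∞) u) (j : Fin n) :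
    ContDiff ℝ (⊤ : ℕ∞) (pderiv' j u) :=
  (hu.fderiv_right (m := (⊤ : ℕ∞)) (by simp)).clm_apply contDiff_const

lemma tsupport_pderiv'_subset (u : (Fin n → ℝ) → ℝ) (j : Fin n) :
    tsupport (pderiv' j u) ⊆ tsupport u :=
  tsupport_fderiv_apply_subset ℝ _

lemma pderiv'_mul {f g : (Fin n → ℝ) → ℝ} {x : Fin n → ℝ} (hf : DifferentiableAt ℝ f x)
    (hg : DifferentiableAt ℝ g x) (j : Fin n) :
    pderiv' j (fun y => f y * g y) x = f x * pderiv' j g x + pderiv' j f x * g x := by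
  simp only [pderiv']
  rw [fderiv_fun_mul hf hg]
  simp [mul_comm]

lemma continuous_hypLap {u : (Fin n → ℝ) → ℝ} (hu : ContDiff ℝ (⊤ : ℕ∞) u) :
    Continuous (hypLap ln u) := by
  have h₁ := (hu.pderiv' ln).continuous
  have h₂ : ∀ j, Continuous (pderiv' j (pderiv' j u)) :=
    fun j => ((hu.pderiv' j).pderiv' j).continuous
  unfold hypLap
  fun_prop

lemma hypLap_eq_zero_of_notMem_tsupport {u : (Fin n → ℝ) → ℝ} {x : Fin n → ℝ}
    (hx : x ∉ tsupport u) : hypLap ln u x = 0 := by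
  have h₁ : ∀ j, pderiv' j u x = 0 := fun j =>
    image_eq_zero_of_notMem_tsupport fun h => hx (tsupport_pderiv'_subset u j h)
  have h₂ : ∀ j, pderiv' j (pderiv' j u) x = 0 := fun j =>
    image_eq_zero_of_notMem_tsupport fun h =>
      hx (tsupport_pderiv'_subset u j (tsupport_pderiv'_subset _ j h))
  simp [hypLap, h₁, h₂]

/-- A continuous function vanishing off the support of `u` is integrable on the half-space
against any power of the height. -/
lemma integrableOn_mul_rpow_of_eq_zero {u f : (Fin n → ℝ) → ℝ} (hcs : HasCompactSupport u)
    (hsupp : tsupport u ⊆ {y | 0 < y ln}) (hf : Continuous f)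
    (h0 : ∀ x, x ∉ tsupport u → f x = 0) (p : ℝ) :
    IntegrableOn (fun x => f x * x ln ^ p) {y | 0 < y ln} := by
  have hsub : tsupport f ⊆ tsupport u :=
    closure_minimal (fun x hx => by_contra fun h => hx (h0 x h)) isClosed_closure
  exact (integrable_mul_rpow_of_tsupport_subset hf
    (hcs.of_isClosed_subset (isClosed_tsupport f) hsub) (hsub.trans hsupp) p).integrableOn

lemma two_mul_setIntegral_mul_height_pderiv {u : (Fin n → ℝ) → ℝ} (hu : ContDiff ℝ (⊤ : ℕ∞) u)
    (hcs : HasCompactSupport u) (hsupp : tsupport u ⊆ {y | 0 < y ln}) :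
    2 * ∫ x in {y : Fin n → ℝ | 0 < y ln}, u x * (x ln * pderiv' ln u x) * x ln ^ (-(n : ℝ)) =
      ((n : ℝ) - 1) * ∫ x in {y : Fin n → ℝ | 0 < y ln}, u x ^ 2 * x ln ^ (-(n : ℝ)) := by
  have hu1 : ContDiff ℝ 1 u := hu.of_le (by exact_mod_cast le_top)
  have hd := hu1.differentiable one_ne_zero
  have hcont := hu.continuous
  have hdcont := (hu.pderiv' ln).continuous
  have key := setIntegral_pderiv_mul_rpow_add_eq_zero (ln := ln) (g := fun x => u x * u x)
    (hu1.mul hu1) hcs.mul_right ((tsupport_mul_subset_left).trans hsupp) (1 - n) ln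
  have i₁ := integrableOn_mul_rpow_of_eq_zero (f := fun x => u x * (x ln * pderiv' ln u x))
    hcs hsupp (by fun_prop) (fun x hx => by simp [image_eq_zero_of_notMem_tsupport hx]) (-(n : ℝ))
  have i₂ := integrableOn_mul_rpow_of_eq_zero (f := fun x => u x ^ 2)
    hcs hsupp (by fun_prop) (fun x hx => by simp [image_eq_zero_of_notMem_tsupport hx]) (-(n : ℝ))
  rw [← integral_const_mul, ← integral_const_mul, ← sub_eq_zero,
    ← integral_sub (i₁.const_mul 2) (i₂.const_mul _)]
  refine Eq.trans ?_ key
  refine setIntegral_congr_fun (measurableSet_halfSpace ln) fun x hx => ?_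
  have hx : 0 < x ln := hx
  have hp : x ln ^ (1 - (n : ℝ)) = x ln * x ln ^ (-(n : ℝ)) := by
    rw [sub_eq_add_neg, Real.rpow_add hx, Real.rpow_one]
  have hp' : (1 : ℝ) - n - 1 = -n := by ring
  simp only [pderiv'_mul (hd x) (hd x), hp, hp', Pi.single_eq_same]
  ring

/-- The vertical part of the Dirichlet energy is at most the full energy `-∫ u Δ_ℍ u dμ`. -/
lemma setIntegral_height_pderiv_sq_le {u : (Fin n → ℝ) → ℝ} (hu : ContDiff ℝ (⊤ : ℕ∞) u)
    (hcs : HasCompactSupport u) (hsupp : tsupport u ⊆ {y | 0 < y ln}) :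
    ∫ x in {y : Fin n → ℝ | 0 < y ln}, (x ln * pderiv' ln u x) ^ 2 * x ln ^ (-(n : ℝ)) ≤
      -∫ x in {y : Fin n → ℝ | 0 < y ln}, u x * hypLap ln u x * x ln ^ (-(n : ℝ)) := by
  have hu1 : ContDiff ℝ 1 u := hu.of_le (by exact_mod_cast le_top)
  have hd := hu1.differentiable one_ne_zero
  have hd1 : ∀ j, ContDiff ℝ 1 (pderiv' j u) :=
    fun j => (hu.pderiv' j).of_le (by exact_mod_cast le_top)
  have hd2 := fun j => (hd1 j).differentiable one_ne_zero
  have hcont := hu.continuous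
  have hdcont := fun j => (hu.pderiv' j).continuous
  have hLcont := continuous_hypLap (ln := ln) hu
  have hd0 : ∀ j x, x ∉ tsupport u → pderiv' j u x = 0 := fun j x hx =>
    image_eq_zero_of_notMem_tsupport fun h => hx (tsupport_pderiv'_subset u j h)
  have key := fun j => setIntegral_pderiv_mul_rpow_add_eq_zero (ln := ln)
    (g := fun x => u x * pderiv' j u x)
    (hu1.mul (hd1 j)) hcs.mul_right ((tsupport_mul_subset_left).trans hsupp) (2 - n) j
  have i₁ := integrableOn_mul_rpow_of_eq_zero (f := fun x => (x ln * pderiv' ln u x) ^ 2)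
    hcs hsupp (by fun_prop) (fun x hx => by simp [hd0 _ x hx]) (-(n : ℝ))
  have i₂ := integrableOn_mul_rpow_of_eq_zero (f := fun x => u x * hypLap ln u x)
    hcs hsupp (by fun_prop) (fun x hx => by simp [image_eq_zero_of_notMem_tsupport hx]) (-(n : ℝ))
  have i₃ := integrableOn_mul_rpow_of_eq_zero
    (f := fun x => ∑ j, (x ln * pderiv' j u x) ^ 2)
    hcs hsupp (by fun_prop) (fun x hx => by simp [hd0 _ x hx]) (-(n : ℝ))
  have energy : ∫ x in {y : Fin n → ℝ | 0 < y ln},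
      ((∑ j, (x ln * pderiv' j u x) ^ 2) * x ln ^ (-(n : ℝ)) +
        u x * hypLap ln u x * x ln ^ (-(n : ℝ))) = 0 := by
    have hsum := Finset.sum_eq_zero (s := Finset.univ) fun j _ => key j
    rw [← integral_finsetSum] at hsum
    · refine Eq.trans ?_ hsum
      refine setIntegral_congr_fun (measurableSet_halfSpace ln) fun x hx => ?_
      have hx : 0 < x ln := hx
      have hp : x ln ^ (2 - (n : ℝ)) = x ln ^ 2 * x ln ^ (-(n : ℝ)) := by
        rw [sub_eq_add_neg, Real.rpow_add hx, Real.rpow_two]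
      have hp' : x ln ^ (2 - (n : ℝ) - 1) = x ln * x ln ^ (-(n : ℝ)) := by
        rw [show (2 : ℝ) - n - 1 = 1 + -n by ring, Real.rpow_add hx, Real.rpow_one]
      simp only [pderiv'_mul (hd x) (hd2 _ x), hp, hp', hypLap]
      have hs : ∑ j, u x * pderiv' j u x * (Pi.single j 1 : Fin n → ℝ) ln * (2 - (n : ℝ)) *
          (x ln * x ln ^ (-(n : ℝ))) =
          u x * pderiv' ln u x * (2 - (n : ℝ)) * (x ln * x ln ^ (-(n : ℝ))) := by
        rw [Finset.sum_eq_single ln]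
        · simp
        · intro j _ hj
          simp [Pi.single_eq_of_ne hj.symm]
        · simp
      rw [Finset.sum_add_distrib, hs, mul_add, add_mul, ← add_assoc, Finset.mul_sum,
        Finset.mul_sum, Finset.sum_mul, Finset.sum_mul, ← Finset.sum_add_distrib]
      congr 1
      · exact Finset.sum_congr rfl fun j _ => by ring
      · ring
    · intro j _
      have hddcont := ((hu.pderiv' j).pderiv' j).continuous
      have j₁ := integrableOn_mul_rpow_of_eq_zero
        (f := fun x => u x * pderiv' j (pderiv' j u) x + pderiv' j u x * pderiv' j u x)
        hcs hsupp (by fun_prop)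
        (fun x hx => by simp [hd0 _ x hx, image_eq_zero_of_notMem_tsupport hx]) (2 - (n : ℝ))
      have j₂ := integrableOn_mul_rpow_of_eq_zero
        (f := fun x => u x * pderiv' j u x * (Pi.single j 1 : Fin n → ℝ) ln * (2 - (n : ℝ)))
        hcs hsupp (by fun_prop) (fun x hx => by simp [hd0 _ x hx]) (2 - (n : ℝ) - 1)
      simp only [pderiv'_mul (hd _) (hd2 _ _)]
      exact j₁.add j₂
  rw [integral_add i₃ i₂] at energy
  have hle := setIntegral_mono_on i₁ i₃ (measurableSet_halfSpace ln) fun x hx =>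
    mul_le_mul_of_nonneg_right
      (Finset.single_le_sum (f := fun j => (x ln * pderiv' j u x) ^ 2)
        (fun j _ => sq_nonneg _) (Finset.mem_univ ln))
      (Real.rpow_nonneg (le_of_lt hx) _)
  linarith

lemma abs_setIntegral_mul_hypLap_le {u : (Fin n → ℝ) → ℝ} (hu : ContDiff ℝ (⊤ : ℕ∞) u)
    (hcs : HasCompactSupport u) (hsupp : tsupport u ⊆ {y | 0 < y ln})
    (hnorm : ∫ x in {y : Fin n → ℝ | 0 < y ln}, u x ^ 2 * x ln ^ (-(n : ℝ)) = 1) :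
    |∫ x in {y : Fin n → ℝ | 0 < y ln}, u x * hypLap ln u x * x ln ^ (-(n : ℝ))| ≤
      √(∫ x in {y : Fin n → ℝ | 0 < y ln}, hypLap ln u x ^ 2 * x ln ^ (-(n : ℝ))) := by
  have hcont := hu.continuous
  have hLcont := continuous_hypLap (ln := ln) hu
  have i₁ := integrableOn_mul_rpow_of_eq_zero (f := fun x => u x ^ 2)
    hcs hsupp (by fun_prop) (fun x hx => by simp [image_eq_zero_of_notMem_tsupport hx]) (-(n : ℝ))
  have i₂ := integrableOn_mul_rpow_of_eq_zero (f := fun x => u x * hypLap ln u x)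
    hcs hsupp (by fun_prop) (fun x hx => by simp [image_eq_zero_of_notMem_tsupport hx]) (-(n : ℝ))
  have i₃ := integrableOn_mul_rpow_of_eq_zero (f := fun x => hypLap ln u x ^ 2)
    hcs hsupp (by fun_prop) (fun x hx => by simp [hypLap_eq_zero_of_notMem_tsupport hx]) (-(n : ℝ))
  apply Real.abs_le_sqrt
  set B := ∫ x in {y : Fin n → ℝ | 0 < y ln}, u x * hypLap ln u x * x ln ^ (-(n : ℝ))
  have hnn : 0 ≤ ∫ x in {y : Fin n → ℝ | 0 < y ln},
      (hypLap ln u x - B * u x) ^ 2 * x ln ^ (-(n : ℝ)) :=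
    setIntegral_nonneg (measurableSet_halfSpace ln) fun x hx =>
      mul_nonneg (sq_nonneg _) (Real.rpow_nonneg (le_of_lt hx) _)
  have hexp : ∫ x in {y : Fin n → ℝ | 0 < y ln},
      (hypLap ln u x - B * u x) ^ 2 * x ln ^ (-(n : ℝ)) =
      ∫ x in {y : Fin n → ℝ | 0 < y ln}, (hypLap ln u x ^ 2 * x ln ^ (-(n : ℝ)) -
        2 * B * (u x * hypLap ln u x * x ln ^ (-(n : ℝ))) +
        B ^ 2 * (u x ^ 2 * x ln ^ (-(n : ℝ)))) :=
    integral_congr_ae (.of_forall fun x => by ring)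
  rw [hexp, integral_add (by exact i₃.sub (i₂.const_mul _)) (i₁.const_mul _),
    integral_sub i₃ (i₂.const_mul _), integral_const_mul, integral_const_mul, hnorm] at hnn
  linarith

end HalfSpace

/-- For `u` smooth and compactly supported in the half-space `{x ∈ ℝⁿ : x_n > 0}` (`n ≥ 2`)
with `∫ u² dμ = 1` (`dμ = x_n^{-n} dx` the hyperbolic volume), one has
`2(1-n) ∫ u x_n ∂u/∂x_n dμ + 4 ∫ (x_n ∂u/∂x_n)² dμ - 2 ∫ u Δ_ℍ u dμ ≤ 6 √(∫ (Δ_ℍ u)² dμ) - (n-1)²`. -/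
theorem commutator_biharmonic_le (n : ℕ) (hn : 2 ≤ n) (u : (Fin n → ℝ) → ℝ)
    (hu : ContDiff ℝ (⊤ : ℕ∞) u) (hcs : HasCompactSupport u)
    (hsupp : tsupport u ⊆ {y : Fin n → ℝ | 0 < y ⟨n - 1, by omega⟩})
    (hnorm : (∫ x in {y : Fin n → ℝ | 0 < y ⟨n - 1, by omega⟩},
        (u x) ^ 2 * (x ⟨n - 1, by omega⟩) ^ (-(n : ℝ))) = 1) :
    2 * (1 - (n : ℝ)) *
        (∫ x in {y : Fin n → ℝ | 0 < y ⟨n - 1, by omega⟩},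
          u x * (x ⟨n - 1, by omega⟩ * pderiv' ⟨n - 1, by omega⟩ u x) *
            (x ⟨n - 1, by omega⟩) ^ (-(n : ℝ))) +
      4 * (∫ x in {y : Fin n → ℝ | 0 < y ⟨n - 1, by omega⟩},
          (x ⟨n - 1, by omega⟩ * pderiv' ⟨n - 1, by omega⟩ u x) ^ 2 *
            (x ⟨n - 1, by omega⟩) ^ (-(n : ℝ))) -
      2 * (∫ x in {y : Fin n → ℝ | 0 < y ⟨n - 1, by omega⟩},
          u x * hypLap ⟨n - 1, by omega⟩ u x *
            (x ⟨n - 1, by omega⟩) ^ (-(n : ℝ))) ≤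
      6 * Real.sqrt (∫ x in {y : Fin n → ℝ | 0 < y ⟨n - 1, by omega⟩},
          (hypLap ⟨n - 1, by omega⟩ u x) ^ 2 * (x ⟨n - 1, by omega⟩) ^ (-(n : ℝ))) -
        ((n : ℝ) - 1) ^ 2 := by
  have h₁ := two_mul_setIntegral_mul_height_pderiv hu hcs hsupp
  have h₂ := setIntegral_height_pderiv_sq_le hu hcs hsupp
  have h₃ := (abs_le.1 (abs_setIntegral_mul_hypLap_le hu hcs hsupp hnorm)).1
  rw [hnorm] at h₁
  linear_combination 4 * h₂ + 6 * h₃ + (1 - (n : ℝ)) * h₁
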